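/- Let f(x) = ∑_{j=1}^N c_j e^{2πi λ_jᵀ x} be a trigonometric polynomial on ℝᵈ with pairwise distinct frequencies λ₁,…,λ_N ∈ ℝᵈ and coefficients c₁,…,c_N ∈ ℂ. Let 1 < q ≤ 2 and q' = q/(q−1). Then the Bohr mean M(|f|^q) = lim_{T→∞} (2T)^{-d} ∫_{[-T,T]^d} |f(x)|^q dx exists, and the Hausdorff–Young inequality ( ∑_{j=1}^N |c_j|^{q'} )^{1/q'} ≤ M(|f|^q)^{1/q} holds. -/

import Mathlib

open MeasureTheory Filter Complex

/-- The character `x ↦ e^{2πi νᵀx}` of `ℝᵈ`. -/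
noncomputable def bohrChar {d : ℕ} (ν x : Fin d → ℝ) : ℂ :=
  Complex.exp (2 * (Real.pi : ℂ) * Complex.I * ((∑ i : Fin d, ν i * x i : ℝ) : ℂ))

lemma norm_bohrChar {d : ℕ} (ν x : Fin d → ℝ) : ‖bohrChar ν x‖ = 1 := by
  rw [bohrChar, Complex.norm_exp]
  simp

lemma continuous_bohrChar {d : ℕ} (ν : Fin d → ℝ) : Continuous (bohrChar ν) := by
  unfold bohrChar
  fun_prop

lemma bohrChar_zero {d : ℕ} (x : Fin d → ℝ) : bohrChar 0 x = 1 := by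
  simp [bohrChar]

lemma bohrChar_add {d : ℕ} (ν κ x : Fin d → ℝ) :
    bohrChar (ν + κ) x = bohrChar ν x * bohrChar κ x := by
  rw [bohrChar, bohrChar, bohrChar, ← Complex.exp_add]
  congr 1
  simp only [Pi.add_apply, add_mul, Finset.sum_add_distrib]
  push_cast
  ring

lemma conj_bohrChar {d : ℕ} (ν x : Fin d → ℝ) :
    (starRingEnd ℂ) (bohrChar ν x) = bohrChar (-ν) x := by
  rw [bohrChar, bohrChar, ← Complex.exp_conj]
  congr 1
  simp only [Pi.neg_apply, neg_mul, Finset.sum_neg_distrib, map_mul, Complex.conj_ofReal,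
    Complex.conj_I, map_ofNat]
  push_cast
  ring

lemma bohrChar_eq_prod {d : ℕ} (ν x : Fin d → ℝ) :
    bohrChar ν x = ∏ i, Complex.exp ((2 * (Real.pi : ℂ) * Complex.I * (ν i : ℂ)) * (x i : ℂ)) := by
  rw [bohrChar, ← Complex.exp_sum]
  congr 1
  push_cast
  rw [Finset.mul_sum]
  exact Finset.sum_congr rfl fun i _ => by ring

/-- The uniform probability measure on the cube `[-T, T]ᵈ` (for `T > 0`). -/
noncomputable def cubeMeasure (d : ℕ) (T : ℝ) : Measure (Fin d → ℝ) :=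
  ENNReal.ofReal ((2 * T) ^ d)⁻¹ •
    volume.restrict (Set.Icc (fun _ : Fin d => -T) (fun _ : Fin d => T))

instance isFiniteMeasure_cubeMeasure (d : ℕ) (T : ℝ) : IsFiniteMeasure (cubeMeasure d T) := by
  have : IsFiniteMeasure (volume.restrict
      (Set.Icc (fun _ : Fin d => -T) (fun _ : Fin d => T))) :=
    isFiniteMeasure_restrict.2 isCompact_Icc.measure_lt_top.ne
  exact Measure.smul_finite _ ENNReal.ofReal_ne_top

lemma isProbabilityMeasure_cubeMeasure (d : ℕ) {T : ℝ} (hT : 0 < T) :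
    IsProbabilityMeasure (cubeMeasure d T) := by
  constructor
  rw [cubeMeasure, Measure.smul_apply, Measure.restrict_apply_univ, Real.volume_Icc_pi, smul_eq_mul,
    Finset.prod_const, ← ENNReal.ofReal_pow (by linarith), ← ENNReal.ofReal_mul (by positivity)]
  rw [show T - -T = 2 * T by ring, Finset.card_univ, Fintype.card_fin,
    inv_mul_cancel₀ (by positivity), ENNReal.ofReal_one]

lemma integral_cubeMeasure {E : Type*} [NormedAddCommGroup E] [NormedSpace ℝ E] (d : ℕ) {T : ℝ}
    (hT : 0 < T) (g : (Fin d → ℝ) → E) :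
    ∫ x, g x ∂(cubeMeasure d T) =
      ((2 * T) ^ d)⁻¹ • ∫ x in Set.Icc (fun _ : Fin d => -T) (fun _ : Fin d => T), g x := by
  rw [cubeMeasure, integral_smul_measure, ENNReal.toReal_ofReal (by positivity)]

lemma integrable_cubeMeasure {E : Type*} [NormedAddCommGroup E] {d : ℕ}
    {g : (Fin d → ℝ) → E} (hg : Continuous g) (T : ℝ) : Integrable g (cubeMeasure d T) :=
  (hg.continuousOn.integrableOn_compact isCompact_Icc).smul_measure ENNReal.ofReal_ne_top

lemma tendsto_average_exp (a : ℝ) :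
    Tendsto (fun T : ℝ => ((2 * T : ℝ) : ℂ)⁻¹ *
        ∫ t in Set.Icc (-T) T, Complex.exp ((2 * (Real.pi : ℂ) * Complex.I * (a : ℂ)) * (t : ℂ)))
      atTop (nhds (if a = 0 then 1 else 0)) := by
  split_ifs with ha
  · refine tendsto_const_nhds.congr' ?_
    filter_upwards [eventually_gt_atTop 0] with T hT
    have h : ((2 * T : ℝ) : ℂ) ≠ 0 := by exact_mod_cast (by positivity)
    have h2 : volume.real (Set.Icc (-T) T) = 2 * T := by
      rw [Real.volume_real_Icc_of_le (by linarith)]; ring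
    simp only [ha, ofReal_zero, mul_zero, zero_mul, Complex.exp_zero, integral_const,
      measureReal_restrict_apply_univ, h2]
    rw [Complex.real_smul, mul_one, inv_mul_cancel₀ h]
  · set w : ℂ := 2 * (Real.pi : ℂ) * Complex.I * (a : ℂ) with hw
    have hw0 : w ≠ 0 := by simp [hw, ha, Real.pi_ne_zero]
    have hlim : Tendsto (fun T : ℝ => (2 * T)⁻¹ * (2 / ‖w‖)) atTop (nhds 0) := by
      simpa using (tendsto_inv_atTop_zero.comp
        (tendsto_id.const_mul_atTop (two_pos : (0 : ℝ) < 2))).mul_const (2 / ‖w‖)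
    refine squeeze_zero_norm' ?_ hlim
    filter_upwards [eventually_gt_atTop 0] with T hT
    have hexp : ∀ s : ℝ, ‖Complex.exp (w * s)‖ = 1 := by
      intro s
      rw [Complex.norm_exp, hw]
      simp
    rw [integral_Icc_eq_integral_Ioc, ← intervalIntegral.integral_of_le (by linarith),
      integral_exp_mul_complex hw0, norm_mul, norm_inv, Complex.norm_of_nonneg (by positivity),
      norm_div]
    gcongr
    refine (norm_sub_le _ _).trans ?_
    rw [hexp, hexp]
    norm_num

lemma tendsto_integral_bohrChar {d : ℕ} (ν : Fin d → ℝ) :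
    Tendsto (fun T : ℝ => ∫ x, bohrChar ν x ∂(cubeMeasure d T)) atTop
      (nhds (if ν = 0 then 1 else 0)) := by
  have h := tendsto_finsetProd (Finset.univ : Finset (Fin d)) fun i _ => tendsto_average_exp (ν i)
  have h1 : (∏ i, if ν i = 0 then (1 : ℂ) else 0) = if ν = 0 then 1 else 0 := by
    rw [Fintype.prod_ite_zero]
    simp [funext_iff]
  rw [h1] at h
  refine h.congr' ?_
  filter_upwards [eventually_gt_atTop 0] with T hT
  rw [integral_cubeMeasure d hT, ← Set.pi_univ_Icc, volume_pi, Measure.restrict_pi_pi]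
  simp_rw [bohrChar_eq_prod]
  rw [integral_fintype_prod_eq_prod
    (f := fun i (s : ℝ) => Complex.exp ((2 * (Real.pi : ℂ) * Complex.I * (ν i : ℂ)) * (s : ℂ))),
    Finset.prod_mul_distrib, Complex.real_smul]
  congr 1
  simp only [Finset.prod_const, Finset.card_univ, Fintype.card_fin]
  push_cast
  rw [inv_pow]

/-- The algebra of trigonometric polynomials on `ℝᵈ`. -/
noncomputable def trigPoly (d : ℕ) : Subalgebra ℂ ((Fin d → ℝ) → ℂ) :=
  Algebra.adjoin ℂ (Set.range bohrChar)

lemma exists_mean_of_mem_trigPoly {d : ℕ} {g : (Fin d → ℝ) → ℂ} (hg : g ∈ trigPoly d) :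
    Continuous g ∧ ∃ m : ℂ,
      Tendsto (fun T : ℝ => ∫ x, g x ∂(cubeMeasure d T)) atTop (nhds m) := by
  let φ : Multiplicative (Fin d → ℝ) →* ((Fin d → ℝ) → ℂ) :=
    { toFun := fun ν => bohrChar ν.toAdd
      map_one' := by funext x; exact bohrChar_zero x
      map_mul' := fun ν κ => by funext x; exact bohrChar_add _ _ x }
  have hφ : (Submonoid.closure (Set.range (bohrChar (d := d))) : Set ((Fin d → ℝ) → ℂ)) =
      Set.range bohrChar := by
    have : Set.range (bohrChar (d := d)) = (MonoidHom.mrange φ : Set ((Fin d → ℝ) → ℂ)) := rfl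
    rw [this, Submonoid.closure_eq]
  have hmem : g ∈ Submodule.span ℂ (Set.range (bohrChar (d := d))) := by
    rw [← hφ, ← Algebra.adjoin_eq_span]
    exact hg
  clear hg
  induction hmem using Submodule.span_induction with
  | mem g h =>
    obtain ⟨ν, rfl⟩ := h
    exact ⟨continuous_bohrChar ν, _, tendsto_integral_bohrChar ν⟩
  | zero => exact ⟨continuous_const, 0, by simp⟩
  | add g k _ _ hg hk =>
    obtain ⟨hgc, m, hm⟩ := hg
    obtain ⟨hkc, n, hn⟩ := hk
    refine ⟨hgc.add hkc, m + n, (hm.add hn).congr fun T => ?_⟩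
    exact (integral_add (integrable_cubeMeasure hgc T) (integrable_cubeMeasure hkc T)).symm
  | smul a g _ hg =>
    obtain ⟨hgc, m, hm⟩ := hg
    refine ⟨hgc.const_smul a, a * m, (hm.const_mul a).congr fun T => ?_⟩
    exact (integral_const_mul a g).symm

lemma exists_mean_comp_normSq {d : ℕ} {f : (Fin d → ℝ) → ℂ} (hf : f ∈ trigPoly d)
    (hf' : (fun x => (starRingEnd ℂ) (f x)) ∈ trigPoly d) {R : ℝ} (hR : ∀ x, ‖f x‖ ≤ R)
    {φ : ℝ → ℝ} (hφ : Continuous φ) :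
    ∃ m : ℝ, Tendsto (fun T : ℝ => ∫ x, φ (‖f x‖ ^ 2) ∂(cubeMeasure d T)) atTop (nhds m) := by
  have hcf : Continuous f := (exists_mean_of_mem_trigPoly hf).1
  have hpoly : ∀ p : Polynomial ℝ, ∃ m : ℝ,
      Tendsto (fun T : ℝ => ∫ x, p.eval (‖f x‖ ^ 2) ∂(cubeMeasure d T)) atTop (nhds m) := by
    intro p
    have h1 : Polynomial.aeval (f * fun x => (starRingEnd ℂ) (f x)) (p.map (algebraMap ℝ ℂ)) ∈
        trigPoly d := 
        Algebra.adjoin_le (Set.singleton_subset_iff.2 ((trigPoly d).mul_mem hf hf'))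
          (Polynomial.aeval_mem_adjoin_singleton _ _)
    obtain ⟨-, m, hm⟩ := exists_mean_of_mem_trigPoly h1
    refine ⟨m.re, ((Complex.continuous_re.tendsto m).comp hm).congr fun T => ?_⟩
    have h2 : ∀ x, (Polynomial.aeval (f * fun x => (starRingEnd ℂ) (f x))
        (p.map (algebraMap ℝ ℂ))) x = ((p.eval (‖f x‖ ^ 2) : ℝ) : ℂ) := by
      intro x
      have h3 : (f * fun x => (starRingEnd ℂ) (f x)) x = ((‖f x‖ ^ 2 : ℝ) : ℂ) := by
        rw [Pi.mul_apply, Complex.mul_conj, Complex.normSq_eq_norm_sq]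
      rw [Polynomial.aeval_pi_apply₂, h3, Polynomial.aeval_map_algebraMap]
      exact Polynomial.aeval_algebraMap_apply_eq_algebraMap_eval _ _
    simp only [h2, Function.comp, integral_complex_ofReal, Complex.ofReal_re]
  have hR0 : 0 ≤ R := (norm_nonneg _).trans (hR 0)
  refine cauchy_map_iff_exists_tendsto.1 (Metric.cauchy_iff.2 ⟨inferInstance, fun ε hε => ?_⟩)
  obtain ⟨p, hp⟩ := exists_polynomial_near_of_continuousOn 0 (R ^ 2) φ hφ.continuousOn (ε / 4)
    (by positivity)
  obtain ⟨m, hm⟩ := hpoly p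
  refine ⟨_, image_mem_map ((Metric.tendsto_nhds.1 hm (ε / 4) (by positivity)).and
    (eventually_gt_atTop 0)), ?_⟩
  have key : ∀ T : ℝ, dist (∫ x, p.eval (‖f x‖ ^ 2) ∂(cubeMeasure d T)) m < ε / 4 → 0 < T →
      dist (∫ x, φ (‖f x‖ ^ 2) ∂(cubeMeasure d T)) m < ε / 2 := by
    intro T h1 hT
    have := isProbabilityMeasure_cubeMeasure d hT
    have h2 : dist (∫ x, φ (‖f x‖ ^ 2) ∂(cubeMeasure d T))
        (∫ x, p.eval (‖f x‖ ^ 2) ∂(cubeMeasure d T)) ≤ ε / 4 := by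
      rw [dist_eq_norm, ← integral_sub (integrable_cubeMeasure (by fun_prop) T)
        (integrable_cubeMeasure (by fun_prop) T)]
      refine (norm_integral_le_of_norm_le_const (C := ε / 4) (.of_forall fun x => ?_)).trans
        (by simp)
      rw [norm_sub_rev]
      exact (hp _ ⟨by positivity, by have := hR x; gcongr⟩).le
    linarith [dist_triangle (∫ x, φ (‖f x‖ ^ 2) ∂(cubeMeasure d T))
      (∫ x, p.eval (‖f x‖ ^ 2) ∂(cubeMeasure d T)) m]
  rintro _ ⟨S, ⟨hS, hS0⟩, rfl⟩ _ ⟨T, ⟨hT, hT0⟩, rfl⟩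
  linarith [dist_triangle_right (∫ x, φ (‖f x‖ ^ 2) ∂(cubeMeasure d S))
    (∫ x, φ (‖f x‖ ^ 2) ∂(cubeMeasure d T)) m, key S hS hS0, key T hT hT0]

/-- The analytic family `z ↦ |a|^{z-1} a` through `a` (at `z = 1`), with modulus `|a|^{re z}`. -/
noncomputable def interpPow (a z : ℂ) : ℂ := (‖a‖ : ℂ) ^ (z - 1) * a

lemma interpPow_one (a : ℂ) : interpPow a 1 = a := by
  simp [interpPow]

lemma norm_interpPow (a : ℂ) {z : ℂ} (hz : 0 < z.re) : ‖interpPow a z‖ = ‖a‖ ^ z.re := by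
  rcases eq_or_ne a 0 with rfl | ha
  · simp [interpPow, Real.zero_rpow hz.ne']
  · have h : 0 < ‖a‖ := norm_pos_iff.2 ha
    rw [interpPow, norm_mul, norm_cpow_eq_rpow_re_of_pos h, sub_re, one_re, Real.rpow_sub_one h.ne',
      div_mul_cancel₀ _ h.ne']

lemma hasDerivAt_interpPow (a z : ℂ) :
    HasDerivAt (interpPow a) ((Real.log ‖a‖ : ℂ) * interpPow a z) z := by
  rcases eq_or_ne a 0 with rfl | ha
  · have : interpPow 0 = fun _ => 0 := by funext w; simp [interpPow]
    simpa [this] using hasDerivAt_const z (0 : ℂ)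
  · have h : (‖a‖ : ℂ) ≠ 0 := by simpa using ha
    refine ((((hasDerivAt_id z).sub_const 1).const_cpow (Or.inl h)).mul_const a).congr_deriv ?_
    rw [interpPow, Complex.ofReal_log (norm_nonneg a), id]
    ring

lemma measurable_interpPow {X : Type*} [MeasurableSpace X] {h : X → ℂ} (hh : Measurable h) (z : ℂ) :
    Measurable fun x => interpPow (h x) z := by
  unfold interpPow
  fun_prop

lemma rpow_le_max_one_rpow {u r s : ℝ} (hu : 0 ≤ u) (hr : 0 ≤ r) (hrs : r ≤ s) :
    u ^ r ≤ (max 1 u) ^ s :=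
  (Real.rpow_le_rpow hu (le_max_right _ _) hr).trans
    (Real.rpow_le_rpow_of_exponent_le (le_max_left _ _) hrs)

lemma abs_log_mul_rpow_le {u R δ r s : ℝ} (hu : 0 ≤ u) (huR : u ≤ R) (hR : 1 ≤ R) (hδ : 0 < δ)
    (hr : δ ≤ r) (hs : r ≤ s) : |Real.log u| * u ^ r ≤ 1 / δ + R * R ^ s := by
  rcases hu.eq_or_lt with rfl | hu
  · simp only [Real.log_zero, abs_zero, zero_mul]
    positivity
  rcases le_total u 1 with h1 | h1
  · have h2 := (Real.abs_log_mul_self_rpow_lt u δ hu h1 hδ).le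
    rw [abs_mul, abs_of_nonneg (Real.rpow_nonneg hu.le δ)] at h2
    have h3 : |Real.log u| * u ^ r ≤ |Real.log u| * u ^ δ :=
      mul_le_mul_of_nonneg_left (Real.rpow_le_rpow_of_exponent_ge hu h1 hr) (abs_nonneg _)
    have : 0 ≤ R * R ^ s := by positivity
    linarith
  · have h2 : |Real.log u| ≤ R := by
      rw [abs_of_nonneg (Real.log_nonneg h1)]
      exact (Real.log_le_self hu.le).trans huR
    have h3 : u ^ r ≤ R ^ s :=
      (Real.rpow_le_rpow hu.le huR (hδ.le.trans hr)).trans (Real.rpow_le_rpow_of_exponent_le hR hs)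
    have h4 : |Real.log u| * u ^ r ≤ R * R ^ s := by gcongr
    have : 0 ≤ 1 / δ := by positivity
    linarith

lemma norm_interpPow_mul_le {X : Type*} {h φ : X → ℂ} {R : ℝ}
    (hR : ∀ x, ‖h x‖ ≤ R) (hφ1 : ∀ x, ‖φ x‖ ≤ 1) {z : ℂ} (hz : 0 < z.re) (x : X) :
    ‖interpPow (h x) z * φ x‖ ≤ R ^ z.re := by
  rw [norm_mul, norm_interpPow _ hz]
  have h1 : ‖h x‖ ^ z.re ≤ R ^ z.re := Real.rpow_le_rpow (norm_nonneg _) (hR x) hz.le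
  have h2 : 0 ≤ ‖h x‖ ^ z.re := by positivity
  nlinarith [hφ1 x, norm_nonneg (φ x)]

section Interpolation

variable {X : Type*} [MeasurableSpace X] {μ : Measure X} [IsFiniteMeasure μ]

lemma integrable_of_measurable_of_bounded {g : X → ℂ} (hg : Measurable g) {C : ℝ}
    (hC : ∀ x, ‖g x‖ ≤ C) : Integrable g μ :=
  Integrable.of_bound hg.aestronglyMeasurable C (.of_forall hC)

lemma differentiableOn_integral_interpPow {h φ : X → ℂ} (hh : Measurable h) (hφ : Measurable φ)
    {R : ℝ} (hR1 : 1 ≤ R) (hR : ∀ x, ‖h x‖ ≤ R) (hφ1 : ∀ x, ‖φ x‖ ≤ 1) :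
    DifferentiableOn ℂ (fun z => ∫ x, interpPow (h x) z * φ x ∂μ) {z | 0 < z.re} := by
  intro z (hz : 0 < z.re)
  set δ := z.re / 2 with hδ
  have hball : ∀ w ∈ Metric.ball z δ, δ ≤ w.re ∧ w.re ≤ 3 * δ := by
    intro w hw
    have h1 := (Complex.abs_re_le_norm (w - z)).trans_lt (mem_ball_iff_norm.1 hw)
    rw [sub_re, abs_lt] at h1
    constructor <;> linarith
  refine (hasDerivAt_integral_of_dominated_loc_of_deriv_le
    (F' := fun w x => (Real.log ‖h x‖ : ℂ) * interpPow (h x) w * φ x)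
    (bound := fun _ => 1 / δ + R * R ^ (3 * δ))
    (Metric.ball_mem_nhds z (by positivity : 0 < δ)) (.of_forall fun w => ?_) ?_ ?_ ?_
    (integrable_const _) ?_).2.differentiableAt.differentiableWithinAt
  · exact ((measurable_interpPow hh w).mul hφ).aestronglyMeasurable
  · exact integrable_of_measurable_of_bounded ((measurable_interpPow hh z).mul hφ)
      (norm_interpPow_mul_le hR hφ1 hz)
  · have := measurable_interpPow hh z
    exact Measurable.aestronglyMeasurable (by fun_prop)
  · refine .of_forall fun x w hw => ?_
    obtain ⟨h1, h2⟩ := hball w hw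
    have h3 := abs_log_mul_rpow_le (norm_nonneg (h x)) (hR x) hR1 (by positivity : 0 < δ) h1 h2
    rw [norm_mul, norm_mul, norm_interpPow _ (by linarith), Complex.norm_real, Real.norm_eq_abs]
    refine (mul_le_of_le_one_right (by positivity) (hφ1 x)).trans h3
  · exact .of_forall fun x w _ => (hasDerivAt_interpPow (h x) w).mul_const (φ x)

lemma norm_sum_mul_integral_le_sqrt {ι : Type*} [Fintype ι] {k : X → ℂ} (hk : Measurable k) {R : ℝ}
    (hR : ∀ x, ‖k x‖ ≤ R) {E : ι → X → ℂ} (hE : ∀ j, Measurable (E j))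
    (hE1 : ∀ j x, ‖E j x‖ ≤ 1) (b : ι → ℂ) :
    ‖∑ j, b j * ∫ x, k x * E j x ∂μ‖ ≤ (∫ x, ‖k x‖ ^ (2 : ℝ) ∂μ) ^ (1 / 2 : ℝ) *
      (∑ i, ∑ j, ‖b i‖ * ‖b j‖ * ‖∫ x, E i x * (starRingEnd ℂ) (E j x) ∂μ‖) ^ (1 / 2 : ℝ) := by
  have hEint : ∀ j, Integrable (fun x => k x * E j x) μ := fun j =>
    integrable_of_measurable_of_bounded (hk.mul (hE j)) (C := R * 1) fun x => by
      rw [norm_mul]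
      exact mul_le_mul (hR x) (hE1 j x) (norm_nonneg _) ((norm_nonneg _).trans (hR x))
  set g : X → ℂ := fun x => ∑ j, b j * E j x with hg
  have hgm : Measurable g := by fun_prop
  have hgb : ∀ x, ‖g x‖ ≤ ∑ j, ‖b j‖ := fun x => by
    refine (norm_sum_le _ _).trans (Finset.sum_le_sum fun j _ => ?_)
    rw [norm_mul]
    exact mul_le_of_le_one_right (norm_nonneg _) (hE1 j x)
  have h1 : ∑ j, b j * ∫ x, k x * E j x ∂μ = ∫ x, k x * g x ∂μ := by
    simp_rw [← integral_const_mul]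
    rw [← integral_finsetSum _ fun j _ => (hEint j).const_mul _]
    refine integral_congr_ae (.of_forall fun x => ?_)
    simp only [hg, Finset.mul_sum]
    exact Finset.sum_congr rfl fun j _ => by ring
  have h2 : ∫ x, ‖g x‖ ^ (2 : ℝ) ∂μ ≤
      ∑ i, ∑ j, ‖b i‖ * ‖b j‖ * ‖∫ x, E i x * (starRingEnd ℂ) (E j x) ∂μ‖ := by
    have hEE : ∀ i j, Integrable (fun x => E i x * (starRingEnd ℂ) (E j x)) μ := fun i j =>
      integrable_of_measurable_of_bounded
        ((hE i).mul (Complex.continuous_conj.measurable.comp (hE j))) (C := 1) fun x => by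
          rw [norm_mul, RCLike.norm_conj]
          exact mul_le_one₀ (hE1 i x) (norm_nonneg _) (hE1 j x)
    have h3 : ((∫ x, ‖g x‖ ^ (2 : ℝ) ∂μ : ℝ) : ℂ) =
        ∑ i, ∑ j, b i * (starRingEnd ℂ) (b j) * ∫ x, E i x * (starRingEnd ℂ) (E j x) ∂μ := by
      simp_rw [← integral_const_mul]
      rw [← integral_complex_ofReal]
      simp_rw [← integral_finsetSum _ fun j _ => (hEE _ j).const_mul _]
      rw [← integral_finsetSum _ fun i _ => integrable_finsetSum _ fun j _ => (hEE i j).const_mul _]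
      refine integral_congr_ae (.of_forall fun x => ?_)
      simp only
      rw [Real.rpow_two, ← Complex.normSq_eq_norm_sq, ← Complex.mul_conj, hg]
      simp only [map_sum, map_mul, Finset.sum_mul_sum]
      exact Finset.sum_congr rfl fun i _ => Finset.sum_congr rfl fun j _ => by ring
    calc ∫ x, ‖g x‖ ^ (2 : ℝ) ∂μ ≤ ‖((∫ x, ‖g x‖ ^ (2 : ℝ) ∂μ : ℝ) : ℂ)‖ := by
          rw [Complex.norm_real]; exact Real.le_norm_self _
      _ ≤ _ := by
          rw [h3]
          refine (norm_sum_le _ _).trans (Finset.sum_le_sum fun i _ => ?_)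
          refine (norm_sum_le _ _).trans (Finset.sum_le_sum fun j _ => ?_)
          rw [norm_mul, norm_mul, RCLike.norm_conj]
  rw [h1]
  calc ‖∫ x, k x * g x ∂μ‖ ≤ ∫ x, ‖k x‖ * ‖g x‖ ∂μ := by
        simpa only [norm_mul] using norm_integral_le_integral_norm (μ := μ) fun x => k x * g x
    _ ≤ (∫ x, ‖k x‖ ^ (2 : ℝ) ∂μ) ^ (1 / 2 : ℝ) * (∫ x, ‖g x‖ ^ (2 : ℝ) ∂μ) ^ (1 / 2 : ℝ) := by
        refine integral_mul_le_Lp_mul_Lq_of_nonneg Real.HolderConjugate.two_two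
          (.of_forall fun _ => norm_nonneg _) (.of_forall fun _ => norm_nonneg _) ?_ ?_
        · exact MemLp.of_bound hk.norm.aestronglyMeasurable R (.of_forall fun x => by simpa using hR x)
        · exact MemLp.of_bound hgm.norm.aestronglyMeasurable _
            (.of_forall fun x => by simpa using hgb x)
    _ ≤ _ := by
        refine mul_le_mul_of_nonneg_left (Real.rpow_le_rpow ?_ h2 (by norm_num)) (by positivity)
        positivity

lemma norm_sum_mul_integral_le_interp {ι : Type*} [Fintype ι] {h : X → ℂ} (hh : Measurable h)
    {R : ℝ} (hR1 : 1 ≤ R) (hR : ∀ x, ‖h x‖ ≤ R) {E : ι → X → ℂ} (hE : ∀ j, Measurable (E j))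
    (hE1 : ∀ j x, ‖E j x‖ ≤ 1) (b : ι → ℂ) {q : ℝ} (hq1 : 1 ≤ q) (hq2 : q ≤ 2) :
    ‖∑ j, b j * ∫ x, h x * E j x ∂μ‖ ≤
      ((∫ x, ‖h x‖ ^ q ∂μ) ^ (1 / 2 : ℝ) *
        (∑ i, ∑ j, ‖b i‖ ^ (q / 2) * ‖b j‖ ^ (q / 2) *
          ‖∫ x, E i x * (starRingEnd ℂ) (E j x) ∂μ‖) ^ (1 / 2 : ℝ)) ^ (2 - 2 / q) *
      ((∑ j, ‖b j‖ ^ q) * ∫ x, ‖h x‖ ^ q ∂μ) ^ (2 / q - 1) := by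
  have hq0 : 0 < q := by linarith
  have hbound : ∀ z : ℂ, 0 < z.re → ∀ j, ‖∫ x, interpPow (h x) z * E j x ∂μ‖ ≤
      R ^ z.re * μ.real Set.univ := fun z hz j =>
    norm_integral_le_of_norm_le_const (.of_forall (norm_interpPow_mul_le hR (hE1 j) hz))
  have key := HadamardThreeLines.norm_le_interp_of_mem_verticalClosedStrip'
    (f := fun z => ∑ j, interpPow (b j) z * ∫ x, interpPow (h x) z * E j x ∂μ) (z := 1)
    (l := q / 2) (u := q)
    (a := (∫ x, ‖h x‖ ^ q ∂μ) ^ (1 / 2 : ℝ) *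
        (∑ i, ∑ j, ‖b i‖ ^ (q / 2) * ‖b j‖ ^ (q / 2) *
          ‖∫ x, E i x * (starRingEnd ℂ) (E j x) ∂μ‖) ^ (1 / 2 : ℝ))
    (b := (∑ j, ‖b j‖ ^ q) * ∫ x, ‖h x‖ ^ q ∂μ) (by linarith)
    ⟨by simp only [one_re]; linarith, by simpa using hq1⟩ ?_ ?_ ?_ ?_
  · have e1 : (1 - q / 2) / (q - q / 2) = 2 / q - 1 := by field_simp; ring
    simp only [one_re, interpPow_one, e1] at key
    convert key using 3
    ring
  · refine DifferentiableOn.diffContOnCl (DifferentiableOn.mono (t := {z | 0 < z.re}) ?_ ?_)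
    · refine DifferentiableOn.fun_sum fun j _ => DifferentiableOn.mul ?_ ?_
      · exact fun z _ => (hasDerivAt_interpPow (b j) z).differentiableAt.differentiableWithinAt
      · exact differentiableOn_integral_interpPow hh (hE j) hR1 hR (hE1 j)
    · refine (closure_minimal (t := Complex.re ⁻¹' Set.Icc (q / 2) q) ?_ ?_).trans ?_
      · exact fun z hz => Set.Ioo_subset_Icc_self hz
      · exact isClosed_Icc.preimage Complex.continuous_re
      · exact fun z hz => (by linarith : 0 < q / 2).trans_le hz.1
  · refine ⟨∑ j, (max 1 ‖b j‖) ^ q * (R ^ q * μ.real Set.univ), ?_⟩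
    rintro _ ⟨z, hz, rfl⟩
    have hz0 : 0 < z.re := (by linarith : 0 < q / 2).trans_le hz.1
    refine (norm_sum_le _ _).trans (Finset.sum_le_sum fun j _ => ?_)
    rw [norm_mul, norm_interpPow _ hz0]
    refine mul_le_mul (rpow_le_max_one_rpow (norm_nonneg _) hz0.le hz.2)
      ((hbound z hz0 j).trans ?_) (norm_nonneg _) (by positivity)
    exact mul_le_mul_of_nonneg_right (Real.rpow_le_rpow_of_exponent_le hR1 hz.2) measureReal_nonneg
  · intro z hz
    have hz' : z.re = q / 2 := hz
    have hz0 : 0 < z.re := by linarith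
    have h1 := norm_sum_mul_integral_le_sqrt (μ := μ) (measurable_interpPow hh z)
      (R := R ^ z.re) (fun x => by
        rw [norm_interpPow _ hz0]
        exact Real.rpow_le_rpow (norm_nonneg _) (hR x) hz0.le) hE hE1 (fun j => interpPow (b j) z)
    simp only [norm_interpPow _ hz0, ← Real.rpow_mul (norm_nonneg _), hz'] at h1
    rwa [div_mul_cancel₀ q two_ne_zero] at h1
  · intro z hz
    have hz' : z.re = q := hz
    have hz0 : 0 < z.re := by linarith
    rw [Finset.sum_mul]
    refine (norm_sum_le _ _).trans (Finset.sum_le_sum fun j _ => ?_)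
    rw [norm_mul, norm_interpPow _ hz0, hz']
    refine mul_le_mul_of_nonneg_left ?_ (by positivity)
    refine norm_integral_le_of_norm_le ?_ (.of_forall fun x => ?_)
    · refine Integrable.of_bound (C := R ^ q) (hh.norm.pow_const q).aestronglyMeasurable
        (.of_forall fun x => ?_)
      rw [Real.norm_of_nonneg (by positivity)]
      exact Real.rpow_le_rpow (norm_nonneg _) (hR x) hq0.le
    · rw [norm_mul, norm_interpPow _ hz0, hz']
      exact mul_le_of_le_one_right (by positivity) (hE1 j x)

end Interpolation

lemma le_of_le_rpow_interp {S M q : ℝ} (hS : 0 ≤ S) (hM : 0 ≤ M) (hq : 1 < q)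
    (h : S ≤ (M ^ (1 / 2 : ℝ) * S ^ (1 / 2 : ℝ)) ^ (2 - 2 / q) * (S * M) ^ (2 / q - 1)) :
    S ^ (1 / (q / (q - 1))) ≤ M ^ (1 / q) := by
  have hq0 : 0 < q := by linarith
  have he : 1 / (q / (q - 1)) = 1 - 1 / q := by field_simp
  have he0 : 0 < 1 - 1 / q := by
    rw [sub_pos, div_lt_one hq0]
    exact hq
  rw [he]
  rcases hS.eq_or_lt with rfl | hS
  · rw [Real.zero_rpow he0.ne']
    positivity
  rcases hM.eq_or_lt with rfl | hM
  · rw [Real.zero_rpow (by norm_num), zero_mul, Real.zero_rpow (by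
      have : (2 : ℝ) - 2 / q = 2 * (1 - 1 / q) := by ring
      rw [this]
      positivity), zero_mul] at h
    linarith
  have h1 : (M ^ (1 / 2 : ℝ) * S ^ (1 / 2 : ℝ)) ^ (2 - 2 / q) * (S * M) ^ (2 / q - 1) =
      M ^ (1 / q) * S ^ (1 / q) := by
    rw [← Real.mul_rpow hM.le hS.le, ← Real.rpow_mul (by positivity), mul_comm S M,
      ← Real.rpow_add (by positivity), ← Real.mul_rpow hM.le hS.le]
    congr 1
    ring
  rw [h1] at h
  rw [Real.rpow_sub hS, Real.rpow_one, div_le_iff₀ (by positivity)]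
  exact h

/-- **Hausdorff–Young inequality for trigonometric polynomials, case `1 < q ≤ 2`.**
For a trigonometric polynomial `f(x) = ∑_{j=1}^N c_j e^{2πi λ_jᵀx}` on `ℝᵈ` with
pairwise distinct frequencies, the Bohr mean `M(|f|^q)` exists and
`(∑_j |c_j|^{q'})^{1/q'} ≤ M(|f|^q)^{1/q}`, where `q' = q/(q−1)`. -/
theorem hausdorff_young_trig_poly_low
    (d N : ℕ) (hd : 1 ≤ d)
    (lam : Fin N → (Fin d → ℝ)) (hlam : Function.Injective lam)
    (c : Fin N → ℂ)
    (q : ℝ) (hq1 : 1 < q) (hq2 : q ≤ 2)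
    (f : (Fin d → ℝ) → ℂ)
    (hf : ∀ x : Fin d → ℝ,
      f x = ∑ j : Fin N, c j * Complex.exp (2 * (Real.pi : ℂ) * Complex.I *
        ((∑ i : Fin d, lam j i * x i : ℝ) : ℂ))) :
    ∃ M : ℝ,
      Tendsto
        (fun T : ℝ => ((2 * T) ^ d)⁻¹ *
          ∫ x in Set.Icc (fun _ : Fin d => -T) (fun _ : Fin d => T), ‖f x‖ ^ q)
        atTop (nhds M) ∧
      (∑ j : Fin N, ‖c j‖ ^ (q / (q - 1))) ^ (1 / (q / (q - 1))) ≤ M ^ (1 / q) := by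
  have hfe : f = fun x => ∑ j, c j * bohrChar (lam j) x := funext hf
  have hfc : Continuous f := by
    rw [hfe]
    exact continuous_finsetSum _ fun j _ => continuous_const.mul (continuous_bohrChar _)
  have hq0 : 0 < q := by linarith
  have hqq : 0 < q - 1 := by linarith
  have hchar : ∀ ν : Fin d → ℝ, bohrChar ν ∈ trigPoly d := fun ν =>
    Algebra.subset_adjoin ⟨ν, rfl⟩
  have hfmem : f ∈ trigPoly d := by
    have : f = ∑ j, c j • bohrChar (lam j) := by
      funext x
      simp [hfe]
    rw [this]
    exact Subalgebra.sum_mem _ fun j _ => Subalgebra.smul_mem _ (hchar _) _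
  have hfmem' : (fun x => (starRingEnd ℂ) (f x)) ∈ trigPoly d := by
    have : (fun x => (starRingEnd ℂ) (f x)) = ∑ j, (starRingEnd ℂ) (c j) • bohrChar (-lam j) := by
      funext x
      simp [hfe, conj_bohrChar]
    rw [this]
    exact Subalgebra.sum_mem _ fun j _ => Subalgebra.smul_mem _ (hchar _) _
  set R : ℝ := max 1 (∑ j, ‖c j‖) with hRdef
  have hR : ∀ x, ‖f x‖ ≤ R := fun x => by
    rw [hfe]
    refine (norm_sum_le _ _).trans (le_trans (Finset.sum_le_sum fun j _ => ?_) (le_max_right _ _))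
    rw [norm_mul, norm_bohrChar, mul_one]
  obtain ⟨M, hM⟩ := exists_mean_comp_normSq hfmem hfmem' hR
    (φ := fun t => t ^ (q / 2)) (Real.continuous_rpow_const (by positivity))
  have hpow : ∀ x, (‖f x‖ ^ 2) ^ (q / 2) = ‖f x‖ ^ q := fun x => by
    rw [← Real.rpow_natCast_mul (norm_nonneg _)]
    congr 1
    push_cast
    ring
  simp only [hpow] at hM
  have hM0 : 0 ≤ M := ge_of_tendsto' hM fun T => integral_nonneg fun x => by positivity
  refine ⟨M, hM.congr' ?_, ?_⟩
  · filter_upwards [eventually_gt_atTop 0] with T hT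
    rw [integral_cubeMeasure d hT, smul_eq_mul]
  set q' := q / (q - 1) with hq'
  have hq'1 : q' - 1 = 1 / (q - 1) := by rw [hq']; field_simp; ring
  -- The extremal sequence for the duality between the two conjugate sequence spaces.
  set b : Fin N → ℂ := fun j => ((‖c j‖ ^ (q' - 2) : ℝ) : ℂ) * (starRingEnd ℂ) (c j) with hb
  have hbc : ∀ j, b j * c j = ((‖c j‖ ^ q' : ℝ) : ℂ) := by
    intro j
    rcases eq_or_ne (c j) 0 with h0 | h0
    · simp [h0, Real.zero_rpow (by positivity : q' ≠ 0)]
    · rw [hb]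
      simp only
      rw [mul_assoc, mul_comm _ (c j), Complex.mul_conj, Complex.normSq_eq_norm_sq,
        ← Complex.ofReal_mul, ← Real.rpow_natCast, ← Real.rpow_add (norm_pos_iff.2 h0)]
      congr 2
      push_cast
      ring
  have hbq : ∀ j, ‖b j‖ ^ q = ‖c j‖ ^ q' := by
    intro j
    rcases eq_or_ne (c j) 0 with h0 | h0
    · simp [hb, h0, Real.zero_rpow (by positivity : q' ≠ 0), Real.zero_rpow hq0.ne']
    · have h1 : 0 < ‖c j‖ := norm_pos_iff.2 h0
      rw [hb]
      simp only
      rw [norm_mul, RCLike.norm_conj, Complex.norm_of_nonneg (by positivity),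
        ← Real.rpow_add_one h1.ne', ← Real.rpow_mul h1.le]
      congr 1
      rw [show q' - 2 + 1 = q' - 1 by ring, hq'1, hq']
      ring
  have hbq2 : ∀ j, ‖b j‖ ^ (q / 2) * ‖b j‖ ^ (q / 2) = ‖c j‖ ^ q' := by
    intro j
    rw [← hbq, ← sq, ← Real.rpow_mul_natCast (norm_nonneg _)]
    congr 1
    push_cast
    ring
  have hconj : ∀ i j x, bohrChar (-lam i) x * (starRingEnd ℂ) (bohrChar (-lam j) x) =
      bohrChar (lam j - lam i) x := by
    intro i j x
    rw [conj_bohrChar, ← bohrChar_add, neg_neg, neg_add_eq_sub]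
  have hcoeff : ∀ j, Tendsto (fun T : ℝ => ∫ x, f x * bohrChar (-lam j) x ∂(cubeMeasure d T))
      atTop (nhds (c j)) := by
    intro j
    have h1 := tendsto_finsetSum (Finset.univ : Finset (Fin N)) fun i _ =>
      (tendsto_integral_bohrChar (lam i - lam j)).const_mul (c i)
    have h2 : (∑ i, c i * if lam i - lam j = 0 then (1 : ℂ) else 0) = c j := by
      simp [sub_eq_zero, hlam.eq_iff]
    rw [h2] at h1
    refine h1.congr fun T => ?_
    simp_rw [← integral_const_mul]
    rw [← integral_finsetSum _ fun i _ =>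
      (integrable_cubeMeasure (continuous_bohrChar (lam i - lam j)) T).const_mul (c i)]
    refine integral_congr_ae (.of_forall fun x => ?_)
    simp only [hfe, Finset.sum_mul]
    exact Finset.sum_congr rfl fun i _ => by rw [sub_eq_add_neg, bohrChar_add, mul_assoc]
  have hL : Tendsto (fun T : ℝ =>
      ‖∑ j, b j * ∫ x, f x * bohrChar (-lam j) x ∂(cubeMeasure d T)‖) atTop
      (nhds (∑ j, ‖c j‖ ^ q')) := by
    have h1 := (tendsto_finsetSum (Finset.univ : Finset (Fin N)) fun j _ =>
      (hcoeff j).const_mul (b j)).norm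
    simp_rw [hbc] at h1
    rwa [← Complex.ofReal_sum, Complex.norm_of_nonneg
      (Finset.sum_nonneg fun j _ => by positivity)] at h1
  have hD : Tendsto (fun T : ℝ => ∑ i, ∑ j, ‖b i‖ ^ (q / 2) * ‖b j‖ ^ (q / 2) *
      ‖∫ x, bohrChar (-lam i) x * (starRingEnd ℂ) (bohrChar (-lam j) x) ∂(cubeMeasure d T)‖) atTop
      (nhds (∑ j, ‖c j‖ ^ q')) := by
    simp_rw [hconj]
    have h1 := tendsto_finsetSum (Finset.univ : Finset (Fin N)) fun i _ =>
      tendsto_finsetSum (Finset.univ : Finset (Fin N)) fun j _ =>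
        (tendsto_integral_bohrChar (lam j - lam i)).norm.const_mul
          (‖b i‖ ^ (q / 2) * ‖b j‖ ^ (q / 2))
    convert h1 using 2
    refine Finset.sum_congr rfl fun i _ => ?_
    rw [Finset.sum_eq_single i]
    · simp [hbq2]
    · intro j _ hji
      simp [sub_eq_zero, hlam.eq_iff, hji]
    · simp
  have h2q : 2 / q ≤ 2 := by rw [div_le_iff₀ hq0]; linarith
  have h2q' : 1 ≤ 2 / q := by rw [le_div_iff₀ hq0]; linarith
  have hRHS := ((((hM.rpow_const (p := 1 / 2) (Or.inr (by norm_num))).mul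
    (hD.rpow_const (p := 1 / 2) (Or.inr (by norm_num)))).rpow_const (p := 2 - 2 / q)
    (Or.inr (by linarith))).mul
    ((hM.const_mul (∑ j, ‖c j‖ ^ q')).rpow_const (p := 2 / q - 1) (Or.inr (by linarith))))
  refine le_of_le_rpow_interp (Finset.sum_nonneg fun j _ => by positivity) hM0 hq1
    (le_of_tendsto_of_tendsto' hL hRHS fun T => ?_)
  have h := norm_sum_mul_integral_le_interp (μ := cubeMeasure d T) hfc.measurable
    (le_max_left 1 (∑ j, ‖c j‖)) hR (fun j => (continuous_bohrChar (-lam j)).measurable)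
    (fun j x => (norm_bohrChar (-lam j) x).le) b hq1.le hq2
  simpa only [hbq] using h
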